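/- For every k ≥ 1 there exists d_{k+1} ∈ ∂_{ε_{k+1}} h(x̄_{k+1}) such that ‖∇g(x̄_{k+1}) + d_{k+1}‖ ≤ (1/α + L) ‖x̄_{k+1} − x̄_k‖ + √(2 ε_{k+1} / α) + ‖e_{k+1}‖. -/

import Mathlib

open scoped RealInnerProductSpace
open Filter

/-- A continuous convex function on a real Hilbert space has a subgradient at every point. -/
theorem ConvexOn.exists_subgradient {E : Type*} [NormedAddCommGroup E] [InnerProductSpace ℝ E]
    [CompleteSpace E] {h : E → ℝ} (hconv : ConvexOn ℝ Set.univ h) (hcont : Continuous h) (x : E) :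
    ∃ z : E, ∀ u, h x + ⟪z, u - x⟫ ≤ h u := by
  have hopen : IsOpen {p : E × ℝ | p.1 ∈ Set.univ ∧ h p.1 < p.2} := by
    simpa using isOpen_lt (hcont.comp continuous_fst) continuous_snd
  obtain ⟨f, hf⟩ := geometric_hahn_banach_open_point (x := ((x, h x) : E × ℝ))
    hconv.convex_strict_epigraph hopen (by simp)
  have hsplit : ∀ y t, f (y, t) = f (y, 0) + t * f (0, 1) := by
    intro y t
    have hyt : ((y, t) : E × ℝ) = (y, 0) + t • (0, 1) := by simp
    rw [hyt, map_add, map_smul, smul_eq_mul]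
  have hstrict : ∀ y t, h y < t →
      f (y, 0) + t * f (0, 1) < f (x, 0) + h x * f (0, 1) := by
    intro y t hyt
    rw [← hsplit, ← hsplit]
    exact hf (y, t) ⟨Set.mem_univ _, hyt⟩
  set c := f (0, 1)
  have hc : c < 0 := by
    have := hstrict x (h x + 1) (by linarith)
    linarith
  let φ : StrongDual ℝ E := (-c)⁻¹ • f.comp (ContinuousLinearMap.inl ℝ E ℝ)
  refine ⟨(InnerProductSpace.toDual ℝ E).symm φ, fun u => ?_⟩
  rw [InnerProductSpace.toDual_symm_apply]
  refine le_of_forall_gt_imp_ge_of_dense fun t ht => ?_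
  have hu := hstrict u t ht
  have hφ : φ (u - x) = (f (u, 0) - f (x, 0)) / (-c) := by
    simp only [φ, map_sub, smul_apply, ContinuousLinearMap.comp_apply,
      ContinuousLinearMap.inl_apply, smul_eq_mul]
    ring
  have hbound : (f (u, 0) - f (x, 0)) / (-c) ≤ t - h x := by
    rw [div_le_iff₀ (by linarith)]
    linarith
  linarith

/-- If all subgradients of a convex function are bounded by `K`, the function is `K`-Lipschitz. -/
theorem ConvexOn.sub_le_of_subgradient_bound {E : Type*} [NormedAddCommGroup E]
    [InnerProductSpace ℝ E] [CompleteSpace E] {h : E → ℝ} (hconv : ConvexOn ℝ Set.univ h)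
    (hcont : Continuous h) {K : ℝ}
    (hsub : ∀ x z : E, (∀ u, h x + ⟪z, u - x⟫ ≤ h u) → ‖z‖ ≤ K) (x y : E) :
    h x - h y ≤ K * ‖x - y‖ := by
  obtain ⟨z, hz⟩ := hconv.exists_subgradient hcont x
  have h1 := hz y
  have h2 : ⟪z, x - y⟫ ≤ ‖z‖ * ‖x - y‖ := real_inner_le_norm _ _
  have h3 : ‖z‖ * ‖x - y‖ ≤ K * ‖x - y‖ := by gcongr; exact hsub x z hz
  rw [← neg_sub x y, inner_neg_right] at h1
  linarith

/-- First-order optimality of a proximal point: `α⁻¹ • (w - p)` is a subgradient at `p`. -/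
theorem ConvexOn.subgradient_of_prox {E : Type*} [NormedAddCommGroup E]
    [InnerProductSpace ℝ E] {h : E → ℝ} (hconv : ConvexOn ℝ Set.univ h) {α : ℝ} {p w : E}
    (hp : ∀ z, h p + (1 / (2 * α)) * ‖p - w‖ ^ 2 ≤ h z + (1 / (2 * α)) * ‖z - w‖ ^ 2) (u : E) :
    h p + ⟪α⁻¹ • (w - p), u - p⟫ ≤ h u := by
  have key : ∀ t : ℝ, 0 < t → t < 1 →
      h p + ⟪α⁻¹ • (w - p), u - p⟫ ≤ h u + t * ((1 / (2 * α)) * ‖u - p‖ ^ 2) := by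
    intro t ht0 ht1
    have hc : h ((1 - t) • p + t • u) ≤ (1 - t) * h p + t * h u :=
      hconv.2 (Set.mem_univ p) (Set.mem_univ u) (by linarith) ht0.le (by ring)
    have hm := hp ((1 - t) • p + t • u)
    have hexp : ‖(1 - t) • p + t • u - w‖ ^ 2
        = ‖p - w‖ ^ 2 - 2 * t * ⟪w - p, u - p⟫ + t ^ 2 * ‖u - p‖ ^ 2 := by
      have hdecomp : (1 - t) • p + t • u - w = (p - w) + t • (u - p) := by module
      rw [hdecomp, norm_add_sq_real, norm_smul, real_inner_smul_right, ← neg_sub w p,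
        inner_neg_left, mul_pow, Real.norm_eq_abs, sq_abs]
      ring
    rw [hexp] at hm
    rw [real_inner_smul_left]
    have hα : (1 / (2 * α)) * (2 * t * ⟪w - p, u - p⟫) = t * (α⁻¹ * ⟪w - p, u - p⟫) := by
      rw [one_div, mul_inv]
      ring
    refine le_of_mul_le_mul_left ?_ ht0
    linarith
  have hlim : Tendsto (fun t : ℝ => h u + t * ((1 / (2 * α)) * ‖u - p‖ ^ 2))
      (nhdsWithin 0 (Set.Ioi 0)) (nhds (h u)) := by
    have hcts : Continuous fun t : ℝ => h u + t * ((1 / (2 * α)) * ‖u - p‖ ^ 2) := by fun_prop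
    simpa using (hcts.tendsto 0).mono_left nhdsWithin_le_nhds
  refine ge_of_tendsto hlim ?_
  filter_upwards [Ioo_mem_nhdsGT (zero_lt_one' ℝ)] with t ht using key t ht.1 ht.2

/-- A mean of `L`-Lipschitz maps is `L`-Lipschitz. -/
theorem norm_mean_sub_mean_le {E F : Type*} [NormedAddCommGroup E] [NormedAddCommGroup F]
    [NormedSpace ℝ F] {m : ℕ} (hm : 1 ≤ m) {G : Fin m → E → F} {L : ℝ}
    (hLip : ∀ i x y, ‖G i x - G i y‖ ≤ L * ‖x - y‖) (x y : E) :
    ‖(m : ℝ)⁻¹ • ∑ i, G i x - (m : ℝ)⁻¹ • ∑ i, G i y‖ ≤ L * ‖x - y‖ := by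
  have hm0 : (0 : ℝ) < m := by exact_mod_cast hm
  rw [← smul_sub, ← Finset.sum_sub_distrib, norm_smul, norm_inv, Real.norm_natCast,
    inv_mul_le_iff₀ hm0]
  simpa using norm_sum_le_of_le Finset.univ fun i _ => hLip i x y

/-- Mixing with weights whose columns sum to one preserves the total. -/
theorem sum_mix_eq_sum {ι E : Type*} [Fintype ι] [AddCommGroup E] [Module ℝ E]
    {w : ι → ι → ℝ} (hcol : ∀ j, ∑ i, w i j = 1) (q : ι → E) :
    ∑ i, ∑ j, w i j • q j = ∑ j, q j := by
  rw [Finset.sum_comm]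
  simp [← Finset.sum_smul, hcol]

theorem stmt_16
    (n m : ℕ) (hn : 0 < n) (hm : 1 ≤ m)
    (g : Fin m → EuclideanSpace ℝ (Fin n) → ℝ)
    (G : Fin m → EuclideanSpace ℝ (Fin n) → EuclideanSpace ℝ (Fin n))
    (L Gg Gh α : ℝ) (hL : 0 < L)
    (hgrad : ∀ i x, HasGradientAt (g i) (G i x) x)
    (hLip : ∀ i x y, ‖G i x - G i y‖ ≤ L * ‖x - y‖)
    (hGg : ∀ i x, ‖G i x‖ ≤ Gg)
    (h : EuclideanSpace ℝ (Fin n) → ℝ)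
    (hconv : ConvexOn ℝ Set.univ h)
    (hGh : 0 < Gh)
    (hsub : ∀ x z : EuclideanSpace ℝ (Fin n), (∀ u, h x + ⟪z, u - x⟫ ≤ h u) → ‖z‖ ≤ Gh)
    (hα0 : 0 < α) (hα1 : α < 1 / L)
    (prox : EuclideanSpace ℝ (Fin n) → EuclideanSpace ℝ (Fin n))
    (hprox : ∀ w z, h (prox w) + (1 / (2 * α)) * ‖prox w - w‖ ^ 2
      ≤ h z + (1 / (2 * α)) * ‖z - w‖ ^ 2)
    (hproxuniq : ∀ w z, (∀ u, h z + (1 / (2 * α)) * ‖z - w‖ ^ 2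
      ≤ h u + (1 / (2 * α)) * ‖u - w‖ ^ 2) → z = prox w)
    (lam : ℕ → Fin m → Fin m → ℝ) (Γ γ : ℝ) (hΓ : 0 < Γ) (hγ0 : 0 < γ) (hγ1 : γ < 1)
    (hlamnn : ∀ k, 2 ≤ k → ∀ i j, 0 ≤ lam k i j)
    (hrow : ∀ k, 2 ≤ k → ∀ i, ∑ j, lam k i j = 1)
    (hcol : ∀ k, 2 ≤ k → ∀ j, ∑ i, lam k i j = 1)
    (hmix : ∀ k, 2 ≤ k → ∀ i j, |lam k i j - 1 / (m : ℝ)| ≤ Γ * γ ^ k)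
    (x q v : ℕ → Fin m → EuclideanSpace ℝ (Fin n))
    (hq : ∀ k, 1 ≤ k → ∀ i, q (k + 1) i = x k i - α • G i (x k i))
    (hv : ∀ k, 1 ≤ k → ∀ i, v (k + 1) i = ∑ j, lam (k + 1) i j • q (k + 1) j)
    (hx : ∀ k, 1 ≤ k → ∀ i, x (k + 1) i = prox (v (k + 1) i))
    (xbar : ℕ → EuclideanSpace ℝ (Fin n))
    (hxbar : ∀ k, xbar k = (m : ℝ)⁻¹ • ∑ i, x k i)
    (vbar zb : ℕ → EuclideanSpace ℝ (Fin n))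
    (hvbar : ∀ k, vbar k = (m : ℝ)⁻¹ • ∑ i, v k i)
    (hzb : ∀ k, zb k = prox (vbar k))
    (gradg : EuclideanSpace ℝ (Fin n) → EuclideanSpace ℝ (Fin n))
    (hgradg : ∀ y, gradg y = (m : ℝ)⁻¹ • ∑ i, G i y)
    (e : ℕ → EuclideanSpace ℝ (Fin n))
    (he : ∀ k, 1 ≤ k → e (k + 1) = (m : ℝ)⁻¹ • ∑ i, (G i (x k i) - G i (xbar k)))
    (eps : ℕ → ℝ)
    (heps : ∀ k, 1 ≤ k → eps (k + 1) =
      ‖xbar (k + 1) - zb (k + 1)‖ * (Gh + α⁻¹ * ‖zb (k + 1) - vbar (k + 1)‖)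
        + (1 / (2 * α)) * ‖xbar (k + 1) - zb (k + 1)‖ ^ 2)
    :
    ∀ k, 1 ≤ k →
      ∃ d : EuclideanSpace ℝ (Fin n),
        (∀ u, h (xbar (k + 1)) + ⟪d, u - xbar (k + 1)⟫ - eps (k + 1) ≤ h u) ∧
        ‖gradg (xbar (k + 1)) + d‖
          ≤ (1 / α + L) * ‖xbar (k + 1) - xbar k‖
            + Real.sqrt (2 * eps (k + 1) / α) + ‖e (k + 1)‖ := by
  intro k hk
  have hvk : vbar (k + 1) = xbar k - α • (gradg (xbar k) + e (k + 1)) := by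
    rw [hvbar, Finset.sum_congr rfl fun i _ => hv k hk i,
      sum_mix_eq_sum (hcol (k + 1) (by omega)), Finset.sum_congr rfl fun i _ => hq k hk i,
      he k hk, hgradg, Finset.sum_sub_distrib, Finset.sum_sub_distrib, ← Finset.smul_sum,
      hxbar k]
    module
  have hsubz : ∀ u, h (zb (k + 1)) +
      ⟪α⁻¹ • (vbar (k + 1) - zb (k + 1)), u - zb (k + 1)⟫ ≤ h u :=
    hconv.subgradient_of_prox (by rw [hzb]; exact hprox _)
  have hgap := hconv.sub_le_of_subgradient_bound hconv.locallyLipschitz.continuous hsub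
    (xbar (k + 1)) (zb (k + 1))
  have hgradLip : ‖gradg (xbar (k + 1)) - gradg (xbar k)‖ ≤ L * ‖xbar (k + 1) - xbar k‖ := by
    rw [hgradg, hgradg]
    exact norm_mean_sub_mean_le hm hLip _ _
  have hepsk := heps k hk
  set X := xbar (k + 1)
  set Z := zb (k + 1)
  set V := vbar (k + 1)
  refine ⟨α⁻¹ • (V - Z), fun u => ?_, ?_⟩
  · have hcs : -⟪α⁻¹ • (V - Z), X - Z⟫ ≤ α⁻¹ * ‖Z - V‖ * ‖X - Z‖ := by
      have hnorm : ‖α⁻¹ • (V - Z)‖ = α⁻¹ * ‖Z - V‖ := by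
        rw [norm_smul, Real.norm_of_nonneg (inv_nonneg.2 hα0.le), norm_sub_rev]
      rw [← hnorm]
      exact (neg_le_abs _).trans (abs_real_inner_le_norm _ _)
    have hsq : 0 ≤ (1 / (2 * α)) * ‖X - Z‖ ^ 2 := by positivity
    have hu := hsubz u
    rw [← sub_add_sub_cancel u X Z, inner_add_right] at hu
    rw [hepsk]
    linarith
  · have hdecomp : gradg X + α⁻¹ • (V - Z) = (gradg X - gradg (xbar k)) + α⁻¹ • (xbar k - X)
        + α⁻¹ • (X - Z) - e (k + 1) := by
      rw [hvk]
      match_scalars <;> field_simp <;> ring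
    have hsqrt : α⁻¹ * ‖X - Z‖ ≤ Real.sqrt (2 * eps (k + 1) / α) := by
      refine Real.le_sqrt_of_sq_le ?_
      have hle : (1 / (2 * α)) * ‖X - Z‖ ^ 2 ≤ eps (k + 1) := by
        rw [hepsk]
        exact le_add_of_nonneg_left (by positivity)
      calc (α⁻¹ * ‖X - Z‖) ^ 2 = 2 * ((1 / (2 * α)) * ‖X - Z‖ ^ 2) / α := by field_simp
        _ ≤ 2 * eps (k + 1) / α := by gcongr
    have hinv : ∀ y : EuclideanSpace ℝ (Fin n), ‖α⁻¹ • y‖ = α⁻¹ * ‖y‖ := fun y => by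
      rw [norm_smul, Real.norm_of_nonneg (inv_nonneg.2 hα0.le)]
    have htri : ‖gradg X + α⁻¹ • (V - Z)‖ ≤ ‖gradg X - gradg (xbar k)‖ + α⁻¹ * ‖X - xbar k‖
        + α⁻¹ * ‖X - Z‖ + ‖e (k + 1)‖ := by
      rw [hdecomp, norm_sub_rev X (xbar k), ← hinv, ← hinv]
      exact (norm_sub_le _ _).trans (add_le_add_left norm_add₃_le _)
    rw [one_div, add_mul]
    linarith
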